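/- arXiv:2104.00816 — 2 statements merged into one kernel-verified Lean document; each statement's English description precedes it below -/
import Mathlib

section
/- Let Ω be a measurable space, let A₁, …, A_k be pairwise disjoint measurable sets covering Ω, let p₁, …, p_k and q₁, …, q_k be probability measures on Ω with pᵢ(Aᵢ) = 1 and qᵢ(Aᵢ) = 1 for every i, and let π₁, …, π_k ≥ 0 with Σᵢ πᵢ = 1. Define P = Σᵢ πᵢ pᵢ and Q = Σᵢ πᵢ qᵢ. Then KL(P ‖ (P + Q)/2) = Σᵢ πᵢ · KL(pᵢ ‖ (pᵢ + qᵢ)/2). -/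
open MeasureTheory
open scoped ENNReal

/-- The Kullback–Leibler divergence `KL(P‖Q) = ∫ log (dP/dQ) dP`, equal to `+∞` if `P` is not
absolutely continuous with respect to `Q` (or if the log-likelihood ratio is not integrable). -/
noncomputable def klDiv {Ω : Type*} [MeasurableSpace Ω] (P Q : Measure Ω) : EReal :=
  open scoped Classical in
  if P ≪ Q ∧ Integrable (llr P Q) P then ((∫ x, llr P Q x ∂P : ℝ) : EReal) else ⊤

theorem rnDeriv_le_of_le_smul {Ω : Type*} [MeasurableSpace Ω] {μ ν : Measure Ω} [SigmaFinite ν]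
    {c : ℝ≥0∞} (h : μ ≤ c • ν) : ∀ᵐ x ∂ν, μ.rnDeriv ν x ≤ c := by
  refine ae_le_of_forall_setLIntegral_le_of_sigmaFinite (μ.measurable_rnDeriv ν) fun s _ _ ↦ ?_
  simpa using (Measure.setLIntegral_rnDeriv_le s).trans (h s)

theorem integrable_llr_of_le_smul {Ω : Type*} [MeasurableSpace Ω] {μ ν : Measure Ω}
    [IsFiniteMeasure μ] [IsFiniteMeasure ν] {c : ℝ≥0∞} (hc : c ≠ ∞) (h : μ ≤ c • ν) :
    Integrable (llr μ ν) μ := by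
  have hac : μ ≪ ν := (Measure.absolutelyContinuous_of_le h).trans
    (Measure.smul_absolutelyContinuous)
  rw [← InformationTheory.integrable_klFun_rnDeriv_iff hac]
  obtain ⟨C, hC⟩ := (isCompact_Icc (a := 0) (b := c.toReal)).exists_bound_of_continuousOn
    InformationTheory.continuous_klFun.continuousOn
  refine Integrable.of_bound (C := C) ?_ ?_
  · exact (InformationTheory.measurable_klFun.comp
      (μ.measurable_rnDeriv ν).ennreal_toReal).aestronglyMeasurable
  · filter_upwards [rnDeriv_le_of_le_smul h] with x hx
    exact hC _ ⟨ENNReal.toReal_nonneg, ENNReal.toReal_mono hc hx⟩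

theorem le_two_smul_half_add {Ω : Type*} [MeasurableSpace Ω] (μ ν : Measure Ω) :
    μ ≤ (2 : ℝ≥0∞) • ((2 : ℝ≥0∞)⁻¹ • (μ + ν)) := by
  rw [smul_smul, ENNReal.mul_inv_cancel two_ne_zero ENNReal.ofNat_ne_top, one_smul]
  exact Measure.le_add_right le_rfl

instance isFiniteMeasure_half_smul {Ω : Type*} [MeasurableSpace Ω] (μ : Measure Ω)
    [IsFiniteMeasure μ] : IsFiniteMeasure ((2 : ℝ≥0∞)⁻¹ • μ) :=
  μ.smul_finite (ENNReal.inv_ne_top.2 two_ne_zero)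

theorem integrable_llr_half_add {Ω : Type*} [MeasurableSpace Ω] (μ ν : Measure Ω)
    [IsFiniteMeasure μ] [IsFiniteMeasure ν] :
    Integrable (llr μ ((2 : ℝ≥0∞)⁻¹ • (μ + ν))) μ :=
  integrable_llr_of_le_smul ENNReal.ofNat_ne_top (le_two_smul_half_add μ ν)

theorem absolutelyContinuous_half_add {Ω : Type*} [MeasurableSpace Ω] (μ ν : Measure Ω) :
    μ ≪ (2 : ℝ≥0∞)⁻¹ • (μ + ν) :=
  (Measure.absolutelyContinuous_of_le (le_two_smul_half_add μ ν)).trans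
    Measure.smul_absolutelyContinuous

theorem klDiv_half_add {Ω : Type*} [MeasurableSpace Ω] (μ ν : Measure Ω)
    [IsFiniteMeasure μ] [IsFiniteMeasure ν] :
    klDiv μ ((2 : ℝ≥0∞)⁻¹ • (μ + ν)) =
      ((∫ x, llr μ ((2 : ℝ≥0∞)⁻¹ • (μ + ν)) x ∂μ : ℝ) : EReal) :=
  if_pos ⟨absolutelyContinuous_half_add μ ν, integrable_llr_half_add μ ν⟩

theorem rnDeriv_restrict_restrict {Ω : Type*} [MeasurableSpace Ω] {μ ν : Measure Ω}
    [SigmaFinite μ] [SigmaFinite ν] (h : μ ≪ ν) {s : Set Ω} (hs : MeasurableSet s) :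
    (μ.restrict s).rnDeriv (ν.restrict s) =ᵐ[ν.restrict s] μ.rnDeriv ν := by
  have := Measure.rnDeriv_withDensity (ν.restrict s) (μ.measurable_rnDeriv ν)
  rwa [← restrict_withDensity hs, Measure.withDensity_rnDeriv_eq _ _ h] at this

/-- If `μ` and `ν` restrict on `s` to the same nonzero multiple of `μ'` and `ν'`, then the
log-likelihood ratios of both pairs agree `μ'`-almost everywhere. -/
theorem llr_ae_eq_of_restrict_eq_smul {Ω : Type*} [MeasurableSpace Ω] {μ ν μ' ν' : Measure Ω}
    [SigmaFinite μ] [SigmaFinite ν] [IsFiniteMeasure μ'] [IsFiniteMeasure ν']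
    (h : μ ≪ ν) (h' : μ' ≪ ν') {s : Set Ω} (hs : MeasurableSet s) {c : NNReal} (hc : c ≠ 0)
    (hμ : μ.restrict s = c • μ') (hν : ν.restrict s = c • ν') :
    llr μ ν =ᵐ[μ'] llr μ' ν' := by
  have h₁ := rnDeriv_restrict_restrict h hs
  rw [hμ, hν] at h₁
  have h₂ : ν' ≪ c • ν' := Measure.AbsolutelyContinuous.rfl.smul_right (ENNReal.coe_ne_zero.2 hc)
  filter_upwards [h'.ae_le (h₂.ae_le h₁), h'.ae_le (Measure.rnDeriv_smul_same μ' ν' hc)]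
    with x hx₁ hx₂
  simp only [llr]
  rw [← hx₁, hx₂]

theorem restrict_sum_smul_of_disjoint {Ω ι : Type*} [MeasurableSpace Ω] [Fintype ι]
    {A : ι → Set Ω} (hA : ∀ i, MeasurableSet (A i)) (hdisj : Pairwise (Function.onFun Disjoint A))
    (p : ι → Measure Ω) [∀ i, IsProbabilityMeasure (p i)] (hp : ∀ i, p i (A i) = 1)
    (c : ι → ℝ≥0∞) (i : ι) : (∑ j, c j • p j).restrict (A i) = c i • p i := by
  have hcompl (j : ι) : p j (A j)ᶜ = 0 := (prob_compl_eq_zero_iff (hA j)).2 (hp j)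
  rw [← Measure.restrictₗ_apply, map_sum, Finset.sum_eq_single i]
  · rw [Measure.restrictₗ_apply, Measure.restrict_smul,
      Measure.restrict_eq_self_of_ae_mem (mem_ae_iff.2 (hcompl i))]
  · intro j _ hji
    rw [Measure.restrictₗ_apply, Measure.restrict_smul, Measure.restrict_eq_zero.2, smul_zero]
    exact measure_mono_null (hdisj hji).subset_compl_left (hcompl j)
  · simp

theorem kl_of_mixtures_eq_mixture_of_kls
    {Ω : Type*} [MeasurableSpace Ω] (k : ℕ) (hk : 1 ≤ k)
    (A : Fin k → Set Ω) (hAmeas : ∀ i, MeasurableSet (A i))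
    (hAdisj : Pairwise (Function.onFun Disjoint A))
    (hAcover : ⋃ i, A i = Set.univ)
    (p q : Fin k → Measure Ω)
    [∀ i, IsProbabilityMeasure (p i)] [∀ i, IsProbabilityMeasure (q i)]
    (hp : ∀ i, p i (A i) = 1) (hq : ∀ i, q i (A i) = 1)
    (π : Fin k → ℝ) (hπ : ∀ i, 0 ≤ π i) (hπsum : ∑ i, π i = 1)
    (P Q : Measure Ω)
    (hP : P = ∑ i : Fin k, ENNReal.ofReal (π i) • p i)
    (hQ : Q = ∑ i : Fin k, ENNReal.ofReal (π i) • q i) :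
    klDiv P ((2 : ℝ≥0∞)⁻¹ • (P + Q))
      = ∑ i : Fin k, (π i : EReal) * klDiv (p i) ((2 : ℝ≥0∞)⁻¹ • (p i + q i)) := by
  have hfin (r : Fin k → Measure Ω) [∀ i, IsProbabilityMeasure (r i)] :
      IsFiniteMeasure (∑ i, ENNReal.ofReal (π i) • r i) := by
    have (i : Fin k) : IsFiniteMeasure (ENNReal.ofReal (π i) • r i) :=
      (r i).smul_finite ENNReal.ofReal_ne_top
    infer_instance
  have : IsFiniteMeasure P := hP ▸ hfin p
  have : IsFiniteMeasure Q := hQ ▸ hfin q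
  have hPr (i : Fin k) : P.restrict (A i) = ENNReal.ofReal (π i) • p i :=
    hP ▸ restrict_sum_smul_of_disjoint hAmeas hAdisj p hp _ i
  have hQr (i : Fin k) : Q.restrict (A i) = ENNReal.ofReal (π i) • q i :=
    hQ ▸ restrict_sum_smul_of_disjoint hAmeas hAdisj q hq _ i
  have hMr (i : Fin k) : ((2 : ℝ≥0∞)⁻¹ • (P + Q)).restrict (A i) =
      ENNReal.ofReal (π i) • ((2 : ℝ≥0∞)⁻¹ • (p i + q i)) := by
    rw [Measure.restrict_smul, Measure.restrict_add, hPr, hQr, ← smul_add, smul_comm]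
  have hsum : ∫ x, llr P ((2 : ℝ≥0∞)⁻¹ • (P + Q)) x ∂P =
      ∑ i, π i * ∫ x, llr (p i) ((2 : ℝ≥0∞)⁻¹ • (p i + q i)) x ∂(p i) := by
    rw [← setIntegral_univ, ← hAcover, integral_iUnion_fintype hAmeas hAdisj
      fun i ↦ (integrable_llr_half_add P Q).integrableOn]
    refine Finset.sum_congr rfl fun i _ ↦ ?_
    rw [hPr, integral_smul_measure, ENNReal.toReal_ofReal (hπ i), smul_eq_mul]
    rcases (hπ i).eq_or_lt with h0 | hpos
    · rw [← h0, zero_mul, zero_mul]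
    · congr 1
      exact integral_congr_ae <| llr_ae_eq_of_restrict_eq_smul
        (absolutelyContinuous_half_add P Q) (absolutelyContinuous_half_add (p i) (q i))
        (hAmeas i) (Real.toNNReal_pos.2 hpos).ne' (hPr i) (hMr i)
  simp only [klDiv_half_add, hsum, ← EReal.coe_mul]
  exact map_sum (⟨⟨Real.toEReal, EReal.coe_zero⟩, EReal.coe_add⟩ : ℝ →+ EReal) _ _
end

section
/- Let d ≥ 1, let c₀ > 0, and let φ : ℝᵈ → ℝᵈ be continuously differentiable with c₀‖x − y‖ ≤ ‖φ(x) − φ(y)‖ for all x, y ∈ ℝᵈ. Then φ is a bijection of ℝᵈ onto ℝᵈ, and its inverse φ⁻¹ is Lipschitz with constant 1/c₀ (in particular, φ is a homeomorphism of ℝᵈ). -/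
open Filter Topology

/-- An expansive map has a derivative that is expansive with the same constant. -/
theorem HasFDerivAt.mul_norm_le_of_expansive {E F : Type*} [NormedAddCommGroup E]
    [NormedSpace ℝ E] [NormedAddCommGroup F] [NormedSpace ℝ F] {f : E → F} {f' : E →L[ℝ] F}
    {x : E} {c : ℝ} (hf : HasFDerivAt f f' x) (hexp : ∀ x y, c * ‖x - y‖ ≤ ‖f x - f y‖) (v : E) :
    c * ‖v‖ ≤ ‖f' v‖ := by
  have h := (hf.hasLineDerivAt v).tendsto_slope_zero.norm
  refine ge_of_tendsto h ?_
  filter_upwards [self_mem_nhdsWithin] with t ht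
  have ht' : 0 < |t| := abs_pos.mpr ht
  have h1 := hexp (x + t • v) x
  rw [add_sub_cancel_left, norm_smul, Real.norm_eq_abs] at h1
  rw [norm_smul, norm_inv, Real.norm_eq_abs, le_inv_mul_iff₀ ht']
  linarith

/-- A `C¹` expansive map of a finite-dimensional real space into itself is surjective. -/
theorem ContDiff.surjective_of_expansive {E : Type*} [NormedAddCommGroup E] [NormedSpace ℝ E]
    [FiniteDimensional ℝ E] {f : E → E} {c : ℝ} (hf : ContDiff ℝ 1 f) (hc : 0 < c)
    (hexp : ∀ x y, c * ‖x - y‖ ≤ ‖f x - f y‖) : Function.Surjective f := by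
  have : ProperSpace E := FiniteDimensional.proper_real E
  have : CompleteSpace E := FiniteDimensional.complete ℝ E
  have hopen : IsOpenMap f := by
    refine IsOpenMap.of_nhds_le fun x => ?_
    have hx : HasStrictFDerivAt f (fderiv ℝ f x) x :=
      hf.contDiffAt.hasStrictFDerivAt one_ne_zero
    have hinj : Function.Injective (fderiv ℝ f x : E →ₗ[ℝ] E) := by
      refine (injective_iff_map_eq_zero _).mpr fun v hv => ?_
      have h := hx.hasFDerivAt.mul_norm_le_of_expansive hexp v
      rw [show fderiv ℝ f x v = 0 from hv, norm_zero] at h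
      exact norm_le_zero_iff.mp (nonpos_of_mul_nonpos_right h hc)
    exact (hx.map_nhds_eq_of_surj
      (LinearMap.range_eq_top.mpr (LinearMap.injective_iff_surjective.mp hinj))).ge
  have hanti : AntilipschitzWith (Real.toNNReal c⁻¹) f := by
    refine AntilipschitzWith.of_le_mul_dist fun x y => ?_
    rw [Real.coe_toNNReal _ (inv_nonneg.mpr hc.le), dist_eq_norm, dist_eq_norm,
      le_inv_mul_iff₀ hc]
    exact hexp x y
  have hclosed : IsClosedMap f := by
    refine (isProperMap_iff_tendsto_cocompact.mpr ⟨hf.continuous, ?_⟩).isClosedMap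
    simpa only [Metric.cobounded_eq_cocompact] using hanti.tendsto_cobounded
  exact Set.range_eq_univ.mp
    (IsClopen.eq_univ ⟨hclosed.isClosed_range, hopen.isOpen_range⟩ (Set.range_nonempty f))

theorem expansive_contDiff_bijective_inverse_lipschitz
    (d : ℕ) (hd : 1 ≤ d) (c₀ : ℝ) (hc₀ : 0 < c₀)
    (φ : EuclideanSpace ℝ (Fin d) → EuclideanSpace ℝ (Fin d))
    (hφ : ContDiff ℝ 1 φ)
    (hexp : ∀ x y, c₀ * ‖x - y‖ ≤ ‖φ x - φ y‖) :
    Function.Bijective φ ∧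
      (∀ x y, ‖Function.invFun φ x - Function.invFun φ y‖ ≤ (1 / c₀) * ‖x - y‖) ∧
      Continuous (Function.invFun φ) := by
  have hsurj := hφ.surjective_of_expansive hc₀ hexp
  have hinj : Function.Injective φ := fun x y hxy => by
    have h := hexp x y
    rw [hxy, sub_self, norm_zero] at h
    exact sub_eq_zero.mp (norm_le_zero_iff.mp (nonpos_of_mul_nonpos_right h hc₀))
  have hlip : ∀ x y,
      ‖Function.invFun φ x - Function.invFun φ y‖ ≤ (1 / c₀) * ‖x - y‖ := fun x y => by
    have h := hexp (Function.invFun φ x) (Function.invFun φ y)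
    rw [Function.rightInverse_invFun hsurj x, Function.rightInverse_invFun hsurj y] at h
    rwa [one_div, le_inv_mul_iff₀ hc₀]
  refine ⟨⟨hinj, hsurj⟩, hlip, (LipschitzWith.of_dist_le' (K := 1 / c₀) fun x y => ?_).continuous⟩
  simpa only [dist_eq_norm] using hlip x y
end
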